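/- arXiv:1908.04033 — 2 statements merged into one kernel-verified Lean document; each statement's English description precedes it below -/
import Mathlib

section
/- Assume d(n) → ∞ and (n − d(n))/√(d(n)) → ρ for some ρ ∈ [0, ∞). Then for every fixed r ∈ ℝ, the ratio I(n,d,−1, r/d)/I(n,d,−1,1) converges, as n → ∞, to Φ(r − ρ√(2/π)). Equivalently, d·H_typ − ρ√(2/π) converges in distribution to a standard normal random variable. -/
open Filter

noncomputable def c1 (d : ℕ) : ℝ :=
  Real.Gamma ((d : ℝ) / 2) / (Real.sqrt Real.pi * Real.Gamma (((d : ℝ) - 1) / 2))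

noncomputable def c2 (d : ℕ) : ℝ :=
  Real.Gamma (((d : ℝ) ^ 2 - 2 * (d : ℝ) + 2) / 2) /
    (Real.sqrt Real.pi * Real.Gamma (((d : ℝ) ^ 2 - 2 * (d : ℝ) + 1) / 2))

/-- `II n d a b` is the integral `I(n,d,a,b)` from the paper. -/
noncomputable def II (n d : ℕ) (a b : ℝ) : ℝ :=
  ∫ h in a..b, (1 - h ^ 2) ^ (((d : ℝ) ^ 2 - 2 * (d : ℝ) - 1) / 2) *
    (c1 d * ∫ s in (-1 : ℝ)..h, (1 - s ^ 2) ^ (((d : ℝ) - 3) / 2)) ^ (n - d)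

/-- `FF n d a b` is the expected number of facets with height in `[a,b]`. -/
noncomputable def FF (n d : ℕ) (a b : ℝ) : ℝ :=
  (n.choose d : ℝ) * 2 * c2 d * II n d a b

/-- The standard normal CDF. -/
noncomputable def stdPhi (r : ℝ) : ℝ :=
  (Real.sqrt (2 * Real.pi))⁻¹ * ∫ s in Set.Iic r, Real.exp (-s ^ 2 / 2)

open Topology MeasureTheory

theorem tendsto_one_add_rpow_exp {ι : Type*} {l : Filter ι} {u y : ι → ℝ} {c : ℝ}
    (hu : Tendsto u l (𝓝 0)) (hyu : Tendsto (fun i => y i * u i) l (𝓝 c)) :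
    Tendsto (fun i => (1 + u i) ^ y i) l (𝓝 (Real.exp c)) := by
  have hu1 : Tendsto (fun i => 1 + u i) l (𝓝 1) := by simpa using hu.const_add 1
  have hslope : Tendsto (fun i => dslope Real.log 1 (1 + u i)) l (𝓝 1) := by
    have hc : ContinuousAt (dslope Real.log 1) 1 :=
      continuousAt_dslope_same.2 (Real.differentiableAt_log one_ne_zero)
    have h := hc.tendsto.comp hu1
    simpa [Function.comp_def] using h
  have hlog : Tendsto (fun i => Real.log (1 + u i) * y i) l (𝓝 c) := by
    have h := hyu.mul hslope
    rw [mul_one] at h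
    refine h.congr fun i => ?_
    have := sub_smul_dslope Real.log 1 (1 + u i)
    simp only [add_sub_cancel_left, smul_eq_mul, Real.log_one, sub_zero] at this
    rw [mul_assoc, this, mul_comm]
  refine ((Real.continuous_exp.tendsto c).comp hlog).congr' ?_
  filter_upwards [hu1.eventually (lt_mem_nhds one_pos)] with i hi
  exact (Real.rpow_def_of_pos hi _).symm

theorem rpow_one_sub_sq_le_exp {h p : ℝ} (hh : |h| ≤ 1) (hp : 0 ≤ p) :
    (1 - h ^ 2) ^ p ≤ Real.exp (-(p * h ^ 2)) := by
  have h0 : 0 ≤ 1 - h ^ 2 := by rw [sub_nonneg, sq_le_one_iff_abs_le_one]; exact hh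
  calc (1 - h ^ 2) ^ p ≤ (Real.exp (-h ^ 2)) ^ p :=
        Real.rpow_le_rpow h0 (by linarith [Real.add_one_le_exp (-h ^ 2)]) hp
    _ = Real.exp (-(p * h ^ 2)) := by rw [← Real.exp_mul]; ring_nf

theorem continuous_rpow_one_sub_sq {p : ℝ} (hp : 0 ≤ p) :
    Continuous fun s : ℝ => (1 - s ^ 2) ^ p :=
  (by fun_prop : Continuous fun s : ℝ => 1 - s ^ 2).rpow_const fun _ => Or.inr hp

/-- The unnormalised mass `∫₀ʰ (1 - s²)^((x-3)/2) ds` of heights in `[0,h]`. -/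
noncomputable def heightMass (x h : ℝ) : ℝ :=
  ∫ s in (0 : ℝ)..h, (1 - s ^ 2) ^ ((x - 3) / 2)

theorem continuous_heightMass {x : ℝ} (hx : 3 ≤ x) : Continuous (heightMass x) :=
  intervalIntegral.continuous_primitive
    (fun _ _ => (continuous_rpow_one_sub_sq (by linarith)).intervalIntegrable _ _) 0

theorem heightMass_neg (x h : ℝ) : heightMass x (-h) = -heightMass x h := by
  have := intervalIntegral.integral_comp_neg
    (f := fun s : ℝ => (1 - s ^ 2) ^ ((x - 3) / 2)) (a := 0) (b := h)
  simp only [neg_sq, neg_zero] at this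
  rw [heightMass, heightMass, this, intervalIntegral.integral_symm]

theorem integral_eq_heightMass {x : ℝ} (hx : 3 ≤ x) (h : ℝ) :
    ∫ s in (-1 : ℝ)..h, (1 - s ^ 2) ^ ((x - 3) / 2) = heightMass x 1 + heightMass x h := by
  have hc : Continuous fun s : ℝ => (1 - s ^ 2) ^ ((x - 3) / 2) :=
    continuous_rpow_one_sub_sq (by linarith)
  have h1 := intervalIntegral.integral_add_adjacent_intervals
    (hc.intervalIntegrable (μ := volume) (-1) 0) (hc.intervalIntegrable (μ := volume) 0 h)
  have h2 := heightMass_neg x 1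
  rw [← h1, intervalIntegral.integral_symm]
  simp only [heightMass] at h2 ⊢
  linarith

theorem heightMass_le {x h : ℝ} (hx : 3 ≤ x) (h0 : 0 ≤ h) (h1 : h ≤ 1) :
    heightMass x h ≤ h := by
  have hc : Continuous fun s : ℝ => (1 - s ^ 2) ^ ((x - 3) / 2) :=
    continuous_rpow_one_sub_sq (by linarith)
  have := intervalIntegral.integral_mono_on h0 (hc.intervalIntegrable (μ := volume) 0 h)
    (continuous_const.intervalIntegrable (μ := volume) (u := fun _ => (1 : ℝ)) 0 h)
    (fun s hs => Real.rpow_le_one (by nlinarith [hs.1, hs.2]) (by nlinarith [hs.1, hs.2])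
      (by linarith))
  simpa [heightMass] using this

theorem heightMass_mono {x h k : ℝ} (hx : 3 ≤ x) (hh : -1 ≤ h) (hhk : h ≤ k) (hk : k ≤ 1) :
    heightMass x h ≤ heightMass x k := by
  have hc : Continuous fun s : ℝ => (1 - s ^ 2) ^ ((x - 3) / 2) :=
    continuous_rpow_one_sub_sq (by linarith)
  have h1 := intervalIntegral.integral_interval_sub_left
    (hc.intervalIntegrable (μ := volume) 0 k) (hc.intervalIntegrable (μ := volume) 0 h)
  have h2 : 0 ≤ ∫ s in h..k, (1 - s ^ 2) ^ ((x - 3) / 2) :=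
    intervalIntegral.integral_nonneg hhk fun s hs =>
      Real.rpow_nonneg (by nlinarith [hs.1, hs.2]) _
  simp only [heightMass]
  linarith

theorem tendsto_sqrt_mul_heightMass_one :
    Tendsto (fun x => √x * heightMass x 1) atTop (𝓝 √(Real.pi / 2)) := by
  have hlim : Tendsto (fun x : ℝ => ∫ t in Set.Ioi (0 : ℝ),
      (Set.Iic √x).indicator (fun t => (1 - (t / √x) ^ 2) ^ ((x - 3) / 2)) t) atTop
      (𝓝 (∫ t in Set.Ioi (0 : ℝ), Real.exp (-(1 / 2) * t ^ 2))) := by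
    refine tendsto_integral_filter_of_dominated_convergence
      (fun t => Real.exp (-(1 / 4) * t ^ 2)) ?_ ?_ ?_ ?_
    · filter_upwards [eventually_ge_atTop 3] with x hx
      exact (((continuous_rpow_one_sub_sq (by linarith)).comp
        (continuous_id.div_const _)).measurable.indicator measurableSet_Iic).aestronglyMeasurable
    · filter_upwards [eventually_ge_atTop 6] with x hx
      refine (ae_restrict_iff' measurableSet_Ioi).2 (Eventually.of_forall fun t ht => ?_)
      have ht : 0 < t := ht
      have hs : 0 < √x := Real.sqrt_pos.2 (by linarith)
      by_cases htx : t ≤ √x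
      · rw [Set.indicator_of_mem (show t ∈ Set.Iic √x from htx)]
        have habs : |t / √x| ≤ 1 := by
          rw [abs_of_pos (div_pos ht hs)]; exact (div_le_one hs).2 htx
        rw [Real.norm_of_nonneg (Real.rpow_nonneg
          (by rw [sub_nonneg, sq_le_one_iff_abs_le_one]; exact habs) _)]
        refine (rpow_one_sub_sq_le_exp habs (by linarith)).trans (Real.exp_le_exp.2 ?_)
        rw [div_pow, Real.sq_sqrt (by linarith), neg_mul, neg_le_neg_iff, mul_div_assoc',
          le_div_iff₀ (by linarith)]
        nlinarith [sq_nonneg t]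
      · rw [Set.indicator_of_notMem (by simpa using htx), norm_zero]
        positivity
    · exact (integrable_exp_neg_mul_sq (by norm_num)).integrableOn
    · refine Eventually.of_forall fun t => ?_
      have hx0 : Tendsto (fun x : ℝ => x⁻¹) atTop (𝓝 0) := tendsto_inv_atTop_zero
      have h1 : Tendsto (fun x : ℝ => -(t ^ 2) * x⁻¹) atTop (𝓝 0) := by
        simpa using hx0.const_mul (-(t ^ 2))
      have h2 : Tendsto (fun x : ℝ => (x - 3) / 2 * (-(t ^ 2) * x⁻¹)) atTop
          (𝓝 (-(1 / 2) * t ^ 2)) := by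
        have : Tendsto (fun x : ℝ => -(1 / 2) * t ^ 2 + (3 / 2 * t ^ 2) * x⁻¹) atTop
            (𝓝 (-(1 / 2) * t ^ 2 + (3 / 2 * t ^ 2) * 0)) := (hx0.const_mul _).const_add _
        rw [mul_zero, add_zero] at this
        refine this.congr' ?_
        filter_upwards [eventually_gt_atTop 0] with x hx
        field_simp
        ring
      refine (tendsto_one_add_rpow_exp h1 h2).congr' ?_
      filter_upwards [eventually_gt_atTop 0, Real.tendsto_sqrt_atTop.eventually_ge_atTop t]
        with x hx htx
      rw [Set.indicator_of_mem (show t ∈ Set.Iic √x from htx), div_pow, Real.sq_sqrt hx.le]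
      congr 1
      ring
  rw [integral_gaussian_Ioi, show √(Real.pi / (1 / 2)) / 2 = √(Real.pi / 2) by
    rw [show Real.pi / (1 / 2) = Real.pi / 2 * 2 ^ 2 by ring,
      Real.sqrt_mul (by positivity), Real.sqrt_sq zero_le_two, mul_div_cancel_right₀ _ two_ne_zero]]
    at hlim
  refine hlim.congr' ?_
  filter_upwards [eventually_gt_atTop 0] with x hx
  have hs : 0 < √x := Real.sqrt_pos.2 hx
  rw [setIntegral_indicator measurableSet_Iic, Set.Ioi_inter_Iic,
    ← intervalIntegral.integral_of_le hs.le,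
    intervalIntegral.integral_comp_div (fun s : ℝ => (1 - s ^ 2) ^ ((x - 3) / 2)) hs.ne',
    zero_div, div_self hs.ne', smul_eq_mul, heightMass]

theorem tendsto_mul_heightMass_div (t : ℝ) :
    Tendsto (fun x => x * heightMass x (t / x)) atTop (𝓝 t) := by
  have hlim : Tendsto (fun x : ℝ => ∫ s in (0 : ℝ)..t, (1 - (s / x) ^ 2) ^ ((x - 3) / 2)) atTop
      (𝓝 (∫ _ in (0 : ℝ)..t, (1 : ℝ))) := by
    refine intervalIntegral.tendsto_integral_filter_of_dominated_convergence (fun _ => 1) ?_ ?_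
      (continuous_const.intervalIntegrable _ _) ?_
    · filter_upwards [eventually_ge_atTop 3] with x hx
      exact ((continuous_rpow_one_sub_sq (by linarith)).comp
        (continuous_id.div_const x)).aestronglyMeasurable
    · filter_upwards [eventually_ge_atTop 3, eventually_ge_atTop |t|] with x hx htx
      refine Eventually.of_forall fun s hs => ?_
      have hst : |s| ≤ |t| := by
        have := Set.abs_sub_left_of_mem_uIcc (Set.uIoc_subset_uIcc hs)
        simpa using this
      have habs : (s / x) ^ 2 ≤ 1 := by
        rw [sq_le_one_iff_abs_le_one, abs_div, abs_of_pos (by linarith : 0 < x),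
          div_le_one (by linarith)]
        exact hst.trans htx
      rw [Real.norm_of_nonneg (Real.rpow_nonneg (by linarith) _)]
      exact Real.rpow_le_one (by linarith) (by linarith [sq_nonneg (s / x)]) (by linarith)
    · refine Eventually.of_forall fun s _ => ?_
      have hx0 : Tendsto (fun x : ℝ => x⁻¹) atTop (𝓝 0) := tendsto_inv_atTop_zero
      have h1 : Tendsto (fun x : ℝ => -(s * x⁻¹) ^ 2) atTop (𝓝 0) := by
        simpa using ((hx0.const_mul s).pow 2).neg
      have h2 : Tendsto (fun x : ℝ => (x - 3) / 2 * (-(s * x⁻¹) ^ 2)) atTop (𝓝 0) := by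
        have : Tendsto (fun x : ℝ => -(s ^ 2 / 2) * x⁻¹ + (3 / 2 * s ^ 2) * x⁻¹ ^ 2) atTop
            (𝓝 (-(s ^ 2 / 2) * 0 + (3 / 2 * s ^ 2) * 0 ^ 2)) :=
          (hx0.const_mul _).add ((hx0.pow 2).const_mul _)
        rw [show -(s ^ 2 / 2) * 0 + (3 / 2 * s ^ 2) * 0 ^ 2 = (0 : ℝ) by ring] at this
        refine this.congr' ?_
        filter_upwards [eventually_gt_atTop 0] with x hx
        field_simp
        ring
      have := tendsto_one_add_rpow_exp h1 h2
      rw [Real.exp_zero] at this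
      exact this.congr fun x => by rw [div_eq_mul_inv]; ring_nf
  rw [intervalIntegral.integral_const, smul_eq_mul, mul_one, sub_zero] at hlim
  refine hlim.congr' ?_
  filter_upwards [eventually_gt_atTop 0] with x hx
  rw [intervalIntegral.integral_comp_div (fun s : ℝ => (1 - s ^ 2) ^ ((x - 3) / 2)) hx.ne',
    zero_div, smul_eq_mul, heightMass]

/-- The density of the rescaled height `d * h`, up to a factor not depending on `t`. -/
noncomputable def scaledDensity (m : ℕ) (x t : ℝ) : ℝ :=
  (1 - (t / x) ^ 2) ^ ((x ^ 2 - 2 * x - 1) / 2) *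
    (1 + heightMass x (t / x) / heightMass x 1) ^ m

theorem continuous_scaledDensity (m : ℕ) {x : ℝ} (hx : 3 ≤ x) :
    Continuous (scaledDensity m x) := by
  have h1 : Continuous fun t : ℝ => t / x := continuous_id.div_const x
  exact ((continuous_rpow_one_sub_sq (by nlinarith)).comp h1).mul
    ((continuous_const.add (((continuous_heightMass hx).comp h1).div_const _)).pow m)

theorem II_eq_mul_integral_scaledDensity {n d : ℕ} (hd : 3 ≤ d)
    (hJ : 0 < heightMass d 1) (R : ℝ) :
    II n d (-1) (R / d) = ((c1 d * heightMass d 1) ^ (n - d) / d) *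
      ∫ t in (-d : ℝ)..R, scaledDensity (n - d) d t := by
  have hd' : (3 : ℝ) ≤ d := by exact_mod_cast hd
  have hd0 : (d : ℝ) ≠ 0 := by positivity
  have h := intervalIntegral.integral_comp_div (a := -(d : ℝ)) (b := R)
    (fun h : ℝ => (1 - h ^ 2) ^ (((d : ℝ) ^ 2 - 2 * d - 1) / 2) *
      (1 + heightMass d h / heightMass d 1) ^ (n - d)) hd0
  rw [neg_div, div_self hd0, smul_eq_mul] at h
  simp only [scaledDensity]
  rw [h, II, ← mul_assoc, div_mul_cancel₀ _ hd0, ← intervalIntegral.integral_const_mul]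
  congr 1
  funext h
  rw [integral_eq_heightMass hd', mul_left_comm, ← mul_pow]
  congr 2
  field_simp

theorem scaledDensity_nonneg {m : ℕ} {x t : ℝ} (hx : 3 ≤ x) (hJ : 0 < heightMass x 1)
    (ht : |t| ≤ x) : 0 ≤ scaledDensity m x t := by
  have hx0 : 0 < x := by linarith
  have habs : |t / x| ≤ 1 := by rw [abs_div, abs_of_pos hx0]; exact (div_le_one hx0).2 ht
  have hb := abs_le.1 habs
  have h1 := heightMass_mono hx le_rfl hb.1 hb.2
  rw [heightMass_neg] at h1
  refine mul_nonneg (Real.rpow_nonneg ?_ _) (pow_nonneg ?_ _)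
  · rw [sub_nonneg, sq_le_one_iff_abs_le_one]; exact habs
  · have : -1 ≤ heightMass x (t / x) / heightMass x 1 := by
      rw [le_div_iff₀ hJ]; linarith
    linarith

theorem scaledDensity_le {m : ℕ} {x t A c : ℝ} (hx : 6 ≤ x) (hc : 0 < c)
    (hJ : c ≤ √x * heightMass x 1) (hm : m / √x ≤ A) (ht : |t| ≤ x) :
    scaledDensity m x t ≤ Real.exp (-(1 / 4) * t ^ 2 + A / c * |t|) := by
  have hx0 : 0 < x := by linarith
  have hs : 0 < √x := Real.sqrt_pos.2 hx0
  have hJ0 : 0 < heightMass x 1 := pos_of_mul_pos_right (hc.trans_le hJ) hs.le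
  have habs : |t / x| ≤ 1 := by rw [abs_div, abs_of_pos hx0]; exact (div_le_one hx0).2 ht
  have hb := abs_le.1 habs
  have h1 := heightMass_mono (by linarith : 3 ≤ x) le_rfl hb.1 hb.2
  rw [heightMass_neg] at h1
  have hbase : 0 ≤ 1 + heightMass x (t / x) / heightMass x 1 := by
    have : -1 ≤ heightMass x (t / x) / heightMass x 1 := by
      rw [le_div_iff₀ hJ0]; linarith
    linarith
  rw [scaledDensity, Real.exp_add]
  refine mul_le_mul ?_ ?_ (pow_nonneg hbase _) (Real.exp_nonneg _)
  · refine (rpow_one_sub_sq_le_exp habs (by nlinarith)).trans (Real.exp_le_exp.2 ?_)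
    rw [div_pow, neg_mul, neg_le_neg_iff, mul_div_assoc', le_div_iff₀ (by positivity)]
    have : x ^ 2 / 4 ≤ (x ^ 2 - 2 * x - 1) / 2 := by nlinarith
    nlinarith [mul_le_mul_of_nonneg_right this (sq_nonneg t)]
  · have hle : heightMass x (t / x) / heightMass x 1 ≤ |t| / (c * √x) := by
      have h2 : heightMass x (t / x) ≤ |t| / x := by
        have h3 : heightMass x (t / x) ≤ heightMass x |t / x| :=
          heightMass_mono (by linarith : 3 ≤ x) hb.1 (le_abs_self _) habs
        have h4 := heightMass_le (by linarith : 3 ≤ x) (abs_nonneg (t / x)) habs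
        rw [abs_div, abs_of_pos hx0] at h3 h4
        exact h3.trans h4
      rw [div_le_div_iff₀ hJ0 (by positivity)]
      calc heightMass x (t / x) * (c * √x) ≤ |t| / x * ((√x * heightMass x 1) * √x) := by
            gcongr
        _ = |t| * heightMass x 1 := by
            rw [mul_right_comm, Real.mul_self_sqrt hx0.le]; field_simp
    calc (1 + heightMass x (t / x) / heightMass x 1) ^ m
        ≤ (Real.exp (|t| / (c * √x))) ^ m := by
          refine pow_le_pow_left₀ hbase ?_ m
          linarith [Real.add_one_le_exp (|t| / (c * √x))]
      _ = Real.exp (m / √x * (|t| / c)) := by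
          rw [← Real.exp_nat_mul]; congr 1; field_simp
      _ ≤ Real.exp (A / c * |t|) := by
          refine Real.exp_le_exp.2 ?_
          calc m / √x * (|t| / c) ≤ A * (|t| / c) := by gcongr
            _ = A / c * |t| := by ring

theorem integrable_exp_neg_mul_sq_add_mul_abs {b : ℝ} (hb : 0 < b) (a : ℝ) :
    Integrable fun t : ℝ => Real.exp (-b * t ^ 2 + a * |t|) := by
  refine Integrable.mono' ((integrable_exp_neg_mul_sq (half_pos hb)).const_mul
    (Real.exp (a ^ 2 / (2 * b)))) (by fun_prop) (Eventually.of_forall fun t => ?_)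
  rw [Real.norm_of_nonneg (Real.exp_nonneg _), ← Real.exp_add, Real.exp_le_exp]
  have h : 0 ≤ (a - b * |t|) ^ 2 / (2 * b) := by positivity
  have h2 : (a - b * |t|) ^ 2 / (2 * b) = a ^ 2 / (2 * b) - a * |t| + b / 2 * t ^ 2 := by
    rw [← sq_abs t]; field_simp; ring
  linarith

theorem tendsto_scaledDensity {m : ℕ → ℕ} {x : ℕ → ℝ} {ρ : ℝ} (hx : Tendsto x atTop atTop)
    (hm : Tendsto (fun n => m n / √(x n)) atTop (𝓝 ρ)) (t : ℝ) :
    Tendsto (fun n => scaledDensity (m n) (x n) t) atTop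
      (𝓝 (Real.exp (-(1 / 2) * t ^ 2 + ρ * √(2 / Real.pi) * t))) := by
  have hinv : Tendsto (fun n => (x n)⁻¹) atTop (𝓝 0) := tendsto_inv_atTop_zero.comp hx
  have hsinv : Tendsto (fun n => (√(x n))⁻¹) atTop (𝓝 0) :=
    tendsto_inv_atTop_zero.comp (Real.tendsto_sqrt_atTop.comp hx)
  rw [Real.exp_add]
  refine Tendsto.mul ?_ ?_
  · have h1 : Tendsto (fun n => -(t * (x n)⁻¹) ^ 2) atTop (𝓝 0) := by
      simpa using ((hinv.const_mul t).pow 2).neg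
    have h2 : Tendsto (fun n => ((x n) ^ 2 - 2 * x n - 1) / 2 * -(t * (x n)⁻¹) ^ 2) atTop
        (𝓝 (-(1 / 2) * t ^ 2)) := by
      have : Tendsto (fun n => -(1 / 2) * t ^ 2 + t ^ 2 * (x n)⁻¹ + t ^ 2 / 2 * (x n)⁻¹ ^ 2) atTop
          (𝓝 (-(1 / 2) * t ^ 2 + t ^ 2 * 0 + t ^ 2 / 2 * 0 ^ 2)) :=
        ((hinv.const_mul _).const_add _).add ((hinv.pow 2).const_mul _)
      rw [show -(1 / 2) * t ^ 2 + t ^ 2 * 0 + t ^ 2 / 2 * 0 ^ 2 = -(1 / 2) * t ^ 2 by ring] at this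
      refine this.congr' ?_
      filter_upwards [hx.eventually_gt_atTop 0] with n hn
      field_simp
      ring
    exact (tendsto_one_add_rpow_exp h1 h2).congr fun n => by rw [div_eq_mul_inv]; ring_nf
  · have hq : Tendsto (fun n => (x n * heightMass (x n) (t / x n)) /
        (√(x n) * heightMass (x n) 1)) atTop (𝓝 (t / √(Real.pi / 2))) :=
      ((tendsto_mul_heightMass_div t).comp hx).div (tendsto_sqrt_mul_heightMass_one.comp hx)
        (by positivity)
    have hqeq : ∀ᶠ n in atTop, heightMass (x n) (t / x n) / heightMass (x n) 1 =
        (√(x n))⁻¹ * ((x n * heightMass (x n) (t / x n)) / (√(x n) * heightMass (x n) 1)) := by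
      filter_upwards [hx.eventually_gt_atTop 0] with n hn
      have hs : 0 < √(x n) := Real.sqrt_pos.2 hn
      have hss := Real.mul_self_sqrt hn.le
      rw [← mul_div_mul_left _ (heightMass (x n) 1) hn.ne', ← div_eq_inv_mul, div_div]
      congr 1
      rw [mul_right_comm, hss]
    have h1 : Tendsto (fun n => heightMass (x n) (t / x n) / heightMass (x n) 1) atTop (𝓝 0) := by
      have := hsinv.mul hq
      rw [zero_mul] at this
      exact this.congr' (hqeq.mono fun n hn => hn.symm)
    have h2 : Tendsto (fun n => (m n : ℝ) * (heightMass (x n) (t / x n) / heightMass (x n) 1))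
        atTop (𝓝 (ρ * √(2 / Real.pi) * t)) := by
      have := hm.mul hq
      rw [show ρ * (t / √(Real.pi / 2)) = ρ * √(2 / Real.pi) * t by
        rw [← inv_div Real.pi 2, Real.sqrt_inv]; ring] at this
      refine this.congr' (hqeq.mono fun n hn => ?_)
      simp only [hn]; ring
    exact (tendsto_one_add_rpow_exp h1 h2).congr fun n => Real.rpow_natCast _ _

theorem tendsto_integral_scaledDensity {m : ℕ → ℕ} {x R : ℕ → ℝ} {ρ : ℝ} {S : Set ℝ}
    (hS : MeasurableSet S) (hx : Tendsto x atTop atTop)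
    (hm : Tendsto (fun n => m n / √(x n)) atTop (𝓝 ρ))
    (hR : ∀ᶠ n in atTop, -x n ≤ R n ∧ R n ≤ x n)
    (hRS : ∀ t, ∀ᶠ n in atTop, t ∈ Set.Ioc (-x n) (R n) ↔ t ∈ S) :
    Tendsto (fun n => ∫ t in (-x n)..R n, scaledDensity (m n) (x n) t) atTop
      (𝓝 (∫ t in S, Real.exp (-(1 / 2) * t ^ 2 + ρ * √(2 / Real.pi) * t))) := by
  set c := √(Real.pi / 2) / 2 with hc
  have hc0 : 0 < c := by positivity
  have hlim : Tendsto (fun n => ∫ t, (Set.Ioc (-x n) (R n)).indicator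
      (scaledDensity (m n) (x n)) t) atTop (𝓝 (∫ t, S.indicator
      (fun t => Real.exp (-(1 / 2) * t ^ 2 + ρ * √(2 / Real.pi) * t)) t)) := by
    refine tendsto_integral_filter_of_dominated_convergence
      (fun t => Real.exp (-(1 / 4) * t ^ 2 + (ρ + 1) / c * |t|)) ?_ ?_
      (integrable_exp_neg_mul_sq_add_mul_abs (by norm_num) _) ?_
    · filter_upwards [hx.eventually_ge_atTop 3] with n hn
      exact ((continuous_scaledDensity (m n) hn).measurable.indicator
        measurableSet_Ioc).aestronglyMeasurable
    · have hJ := (tendsto_sqrt_mul_heightMass_one.comp hx).eventually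
        (lt_mem_nhds (show c < √(Real.pi / 2) from half_lt_self (by positivity)))
      filter_upwards [hx.eventually_ge_atTop 6, hR, hJ,
        hm.eventually (gt_mem_nhds (lt_add_one ρ))] with n hn hRn hJn hmn
      refine Eventually.of_forall fun t => ?_
      by_cases ht : t ∈ Set.Ioc (-x n) (R n)
      · have habs : |t| ≤ x n := abs_le.2 ⟨ht.1.le, ht.2.trans hRn.2⟩
        have hJ0 : 0 < heightMass (x n) 1 :=
          pos_of_mul_pos_right (hc0.trans hJn) (Real.sqrt_nonneg _)
        rw [Set.indicator_of_mem ht,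
          Real.norm_of_nonneg (scaledDensity_nonneg (by linarith) hJ0 habs)]
        exact scaledDensity_le hn hc0 (le_of_lt hJn) hmn.le habs
      · rw [Set.indicator_of_notMem ht, norm_zero]
        positivity
    · refine Eventually.of_forall fun t => ?_
      by_cases ht : t ∈ S
      · rw [Set.indicator_of_mem ht]
        refine (tendsto_scaledDensity hx hm t).congr' ?_
        filter_upwards [hRS t] with n hn
        rw [Set.indicator_of_mem (hn.2 ht)]
      · rw [Set.indicator_of_notMem ht]
        refine tendsto_const_nhds.congr' ?_
        filter_upwards [hRS t] with n hn
        rw [Set.indicator_of_notMem (mt hn.1 ht)]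
  rw [integral_indicator hS] at hlim
  refine hlim.congr' ?_
  filter_upwards [hR] with n hn
  rw [integral_indicator measurableSet_Ioc, intervalIntegral.integral_of_le hn.1]

theorem integral_exp_shift_eq_stdPhi (a r : ℝ) :
    (∫ t in Set.Iic r, Real.exp (-(1 / 2) * t ^ 2 + a * t)) /
      (∫ t, Real.exp (-(1 / 2) * t ^ 2 + a * t)) = stdPhi (r - a) := by
  have hsq : (fun t : ℝ => Real.exp (-(1 / 2) * t ^ 2 + a * t)) =
      fun t => Real.exp (a ^ 2 / 2) * Real.exp (-(1 / 2) * (t - a) ^ 2) := by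
    funext t
    rw [← Real.exp_add]
    congr 1
    ring
  have hshift : ∫ t in Set.Iic r, Real.exp (-(1 / 2) * (t - a) ^ 2) =
      ∫ s in Set.Iic (r - a), Real.exp (-(1 / 2) * s ^ 2) := by
    rw [← integral_indicator measurableSet_Iic, ← integral_indicator measurableSet_Iic,
      ← integral_sub_right_eq_self ((Set.Iic (r - a)).indicator _) a]
    congr 1
    funext t
    simp [Set.indicator_apply]
  rw [hsq, integral_const_mul, integral_const_mul, mul_div_mul_left _ _ (Real.exp_ne_zero _),
    hshift, integral_sub_right_eq_self (fun t : ℝ => Real.exp (-(1 / 2) * t ^ 2)) a,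
    integral_gaussian, stdPhi, div_eq_inv_mul]
  congr 3
  · ring
  · funext s
    ring_nf

/-- in the regime `(n - d)/√d → ρ ∈ [0,∞)` with `d → ∞`, for every fixed `r`,
`I(n,d,-1,r/d)/I(n,d,-1,1) → Φ(r - ρ√(2/π))`, i.e. `d·H_typ - ρ√(2/π) ⟶ N(0,1)`. -/
theorem typical_height_sublinear (d : ℕ → ℕ) (ρ : ℝ) (hρ : 0 ≤ ρ)
    (hd : ∀ᶠ n in atTop, 2 ≤ d n ∧ d n < n)
    (hdi : Tendsto (fun n : ℕ => (d n : ℝ)) atTop atTop)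
    (hreg : Tendsto (fun n : ℕ => ((n : ℝ) - (d n : ℝ)) / Real.sqrt (d n)) atTop (nhds ρ)) :
    ∀ r : ℝ,
      Tendsto (fun n : ℕ => II n (d n) (-1) (r / (d n : ℝ)) / II n (d n) (-1) 1) atTop
        (nhds (stdPhi (r - ρ * Real.sqrt (2 / Real.pi)))) := by
  intro r
  have hm : Tendsto (fun n : ℕ => ((n - d n : ℕ) : ℝ) / √(d n : ℝ)) atTop (𝓝 ρ) := by
    refine hreg.congr' ?_
    filter_upwards [hd] with n hn
    rw [Nat.cast_sub hn.2.le]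
  have hnum := tendsto_integral_scaledDensity (R := fun _ => r) (measurableSet_Iic (a := r))
    hdi hm (by
      filter_upwards [hdi.eventually_ge_atTop |r|] with n hn
      exact abs_le.1 hn) (fun t => by
      filter_upwards [hdi.eventually_gt_atTop (-t)] with n hn
      exact ⟨fun h => h.2, fun h => ⟨by linarith, h⟩⟩)
  have hden := tendsto_integral_scaledDensity (R := fun n => (d n : ℝ)) MeasurableSet.univ
    hdi hm (by
      filter_upwards [hdi.eventually_ge_atTop 0] with n hn
      exact ⟨by linarith, le_rfl⟩) (fun t => by
      filter_upwards [hdi.eventually_gt_atTop |t|] with n hn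
      exact ⟨fun _ => trivial, fun _ => ⟨(abs_lt.1 hn).1, (abs_lt.1 hn).2.le⟩⟩)
  rw [setIntegral_univ] at hden
  have hpos : 0 < ∫ t, Real.exp (-(1 / 2) * t ^ 2 + ρ * √(2 / Real.pi) * t) := by
    refine integral_exp_pos ?_
    refine (integrable_exp_neg_mul_sq_add_mul_abs (b := 1 / 2) (by norm_num)
      (ρ * √(2 / Real.pi))).mono' (by fun_prop) (Eventually.of_forall fun t => ?_)
    rw [Real.norm_of_nonneg (Real.exp_nonneg _)]
    gcongr
    exact le_abs_self t
  rw [← integral_exp_shift_eq_stdPhi]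
  refine (hnum.div hden hpos.ne').congr' ?_
  have hJ := (tendsto_sqrt_mul_heightMass_one.comp hdi).eventually
    (lt_mem_nhds (show 0 < √(Real.pi / 2) by positivity))
  filter_upwards [hdi.eventually_ge_atTop 3, hJ] with n hn hJn
  have hJ0 : 0 < heightMass (d n) 1 := pos_of_mul_pos_right hJn (Real.sqrt_nonneg _)
  have hn' : 3 ≤ d n := by exact_mod_cast hn
  have hc1 : 0 < c1 (d n) :=
    div_pos (Real.Gamma_pos_of_pos (by linarith))
      (mul_pos (Real.sqrt_pos.2 Real.pi_pos) (Real.Gamma_pos_of_pos (by linarith)))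
  have hK : (c1 (d n) * heightMass (d n) 1) ^ (n - d n) / (d n : ℝ) ≠ 0 := by positivity
  have h1 := II_eq_mul_integral_scaledDensity (n := n) hn' hJ0 (d n)
  rw [div_self (by positivity)] at h1
  rw [II_eq_mul_integral_scaledDensity hn' hJ0, h1, mul_div_mul_left _ _ hK, Pi.div_apply]
end

section
/- Assume d(n) → ∞, (n − d)/√d → ∞ and (n − d)/d → 0. Then (d^{3/2}/(n−d))·H_typ converges in probability to √(2/π); concretely, for every fixed ε ∈ (0, √(2/π)), I(n,d,−1, (√(2/π)−ε)(n−d)d^{−3/2})/I(n,d,−1,1) → 0 and I(n,d,−1, (√(2/π)+ε)(n−d)d^{−3/2})/I(n,d,−1,1) → 1 as n → ∞. -/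
open Filter

/-- The symmetric beta integral in the form `∫_{-1}^{1} (1 - s²)^q ds`. -/
lemma integral_one_sub_sq_rpow {q : ℝ} (hq : -1 < q) :
    ∫ s in (-1 : ℝ)..1, (1 - s ^ 2) ^ q =
      Real.sqrt Real.pi * Real.Gamma (q + 1) / Real.Gamma (q + 3 / 2) := by
  have hz : 0 < q + 1 := by linarith
  have hbeta : ∫ x in (0 : ℝ)..1, x ^ q * (1 - x) ^ q = ProbabilityTheory.beta (q + 1) (q + 1) := by
    rw [ProbabilityTheory.beta_eq_betaIntegralReal _ _ hz hz, Complex.betaIntegral]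
    have : ∫ x in (0 : ℝ)..1, (x : ℂ) ^ (((q + 1 : ℝ) : ℂ) - 1) *
        (1 - (x : ℂ)) ^ (((q + 1 : ℝ) : ℂ) - 1) =
        ∫ x in (0 : ℝ)..1, ((x ^ q * (1 - x) ^ q : ℝ) : ℂ) := by
      refine intervalIntegral.integral_congr fun x hx => ?_
      rw [Set.uIcc_of_le zero_le_one] at hx
      have h1 : ((q + 1 : ℝ) : ℂ) - 1 = (q : ℂ) := by push_cast; ring
      simp only [h1]
      rw [Complex.ofReal_mul, Complex.ofReal_cpow hx.1, Complex.ofReal_cpow (by linarith [hx.2])]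
      push_cast
      rfl
    rw [this, intervalIntegral.integral_ofReal, Complex.ofReal_re]
  have hsub := intervalIntegral.integral_comp_mul_sub (a := 0) (b := 1)
    (fun s : ℝ => (1 - s ^ 2) ^ q) (two_ne_zero) 1
  have hcongr : ∫ x in (0 : ℝ)..1, (1 - (2 * x - 1) ^ 2) ^ q =
      4 ^ q * ∫ x in (0 : ℝ)..1, x ^ q * (1 - x) ^ q := by
    rw [← intervalIntegral.integral_const_mul]
    refine intervalIntegral.integral_congr fun x hx => ?_
    rw [Set.uIcc_of_le zero_le_one] at hx
    have h1 : (1 - (2 * x - 1) ^ 2 : ℝ) = 4 * (x * (1 - x)) := by ring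
    simp only [h1]
    rw [Real.mul_rpow (by norm_num) (mul_nonneg hx.1 (by linarith [hx.2])),
      Real.mul_rpow hx.1 (by linarith [hx.2])]
  rw [hcongr, hbeta] at hsub
  norm_num at hsub
  have hdup := Real.Gamma_mul_Gamma_add_half (q + 1)
  have e1 : q + 1 + 1 / 2 = q + 3 / 2 := by ring
  have e2 : (2 : ℝ) * (q + 1) = (q + 1) + (q + 1) := by ring
  have e3 : (2 : ℝ) ^ (1 - (q + 1 + (q + 1))) = (2 * 4 ^ q)⁻¹ := by
    rw [show (4 : ℝ) = 2 ^ (2 : ℝ) by norm_num, ← Real.rpow_mul (by norm_num),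
      show (1 - (q + 1 + (q + 1)) : ℝ) = -(1 + 2 * q) by ring, Real.rpow_neg (by norm_num),
      Real.rpow_add (by norm_num), Real.rpow_one]
  rw [e1, e2, e3] at hdup
  have g1 := Real.Gamma_pos_of_pos hz
  have g2 : 0 < Real.Gamma (q + 3 / 2) := Real.Gamma_pos_of_pos (by linarith)
  have g3 : 0 < Real.Gamma (q + 1 + (q + 1)) := Real.Gamma_pos_of_pos (by linarith)
  have g4 : (0 : ℝ) < 4 ^ q := by positivity
  have hI : ∫ s in (-1 : ℝ)..1, (1 - s ^ 2) ^ q =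
      2 * (4 ^ q * ProbabilityTheory.beta (q + 1) (q + 1)) := by
    rw [hsub]; ring
  rw [hI, ProbabilityTheory.beta]
  generalize Real.Gamma (q + 3 / 2) = B at *
  generalize Real.Gamma (q + 1 + (q + 1)) = C at *
  field_simp at hdup ⊢
  linarith

lemma c1_pos {d : ℕ} (hd : 2 ≤ d) : 0 < c1 d := by
  have h : (2 : ℝ) ≤ d := by exact_mod_cast hd
  have g1 : 0 < Real.Gamma ((d : ℝ) / 2) := Real.Gamma_pos_of_pos (by linarith)
  have g2 : 0 < Real.Gamma (((d : ℝ) - 1) / 2) := Real.Gamma_pos_of_pos (by linarith)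
  unfold c1
  positivity

lemma continuous_one_sub_sq_rpow {q : ℝ} (hq : 0 ≤ q) :
    Continuous fun s : ℝ => (1 - s ^ 2) ^ q :=
  (continuous_const.sub (continuous_pow 2)).rpow_const fun _ => Or.inr hq

lemma c1_mul_integral_neg_one_zero {d : ℕ} (hd : 3 ≤ d) :
    c1 d * ∫ s in (-1 : ℝ)..0, (1 - s ^ 2) ^ (((d : ℝ) - 3) / 2) = 1 / 2 := by
  have h : (3 : ℝ) ≤ d := by exact_mod_cast hd
  have hc := continuous_one_sub_sq_rpow (q := ((d : ℝ) - 3) / 2) (by linarith)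
  have hadd := intervalIntegral.integral_add_adjacent_intervals
    (hc.intervalIntegrable (-1) 0) (hc.intervalIntegrable (μ := MeasureTheory.volume) 0 1)
  have hsymm : ∫ s in (0 : ℝ)..1, (1 - s ^ 2) ^ (((d : ℝ) - 3) / 2) =
      ∫ s in (-1 : ℝ)..0, (1 - s ^ 2) ^ (((d : ℝ) - 3) / 2) := by
    rw [← neg_zero, ← intervalIntegral.integral_comp_neg, neg_zero]
    simp_rw [neg_sq]
  rw [hsymm, integral_one_sub_sq_rpow (by linarith),
    show ((d : ℝ) - 3) / 2 + 1 = ((d : ℝ) - 1) / 2 by ring,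
    show ((d : ℝ) - 3) / 2 + 3 / 2 = (d : ℝ) / 2 by ring] at hadd
  have g1 : 0 < Real.Gamma ((d : ℝ) / 2) := Real.Gamma_pos_of_pos (by linarith)
  have g2 : 0 < Real.Gamma (((d : ℝ) - 1) / 2) := Real.Gamma_pos_of_pos (by linarith)
  have hJ : ∫ s in (-1 : ℝ)..0, (1 - s ^ 2) ^ (((d : ℝ) - 3) / 2) =
      Real.sqrt Real.pi * Real.Gamma (((d : ℝ) - 1) / 2) / Real.Gamma ((d : ℝ) / 2) / 2 := by
    linarith
  rw [hJ, c1]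
  field_simp

lemma Gamma_add_half_sq_le {x : ℝ} (hx : 0 < x) :
    Real.Gamma (x + 1 / 2) ^ 2 ≤ x * Real.Gamma x ^ 2 := by
  have h := Real.Gamma_mul_add_mul_le_rpow_Gamma_mul_rpow_Gamma hx (by linarith : 0 < x + 1)
    (a := 1 / 2) (b := 1 / 2) (by norm_num) (by norm_num) (by norm_num)
  rw [show (1 / 2 * x + 1 / 2 * (x + 1) : ℝ) = x + 1 / 2 by ring, Real.Gamma_add_one hx.ne',
    ← Real.sqrt_eq_rpow, ← Real.sqrt_eq_rpow] at h
  have g := Real.Gamma_pos_of_pos hx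
  have g' : 0 < Real.Gamma (x + 1 / 2) := Real.Gamma_pos_of_pos (by linarith)
  calc Real.Gamma (x + 1 / 2) ^ 2
      ≤ (Real.sqrt (Real.Gamma x) * Real.sqrt (x * Real.Gamma x)) ^ 2 := by gcongr
    _ = x * Real.Gamma x ^ 2 := by
      rw [mul_pow, Real.sq_sqrt g.le, Real.sq_sqrt (by positivity)]; ring

lemma two_c1_div_sqrt_sq_mem {d : ℕ} (hd : 3 ≤ d) :
    2 / Real.pi * (1 - 2 / d) ≤ (2 * c1 d / Real.sqrt d) ^ 2 ∧
      (2 * c1 d / Real.sqrt d) ^ 2 ≤ 2 / Real.pi := by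
  have h : (3 : ℝ) ≤ d := by exact_mod_cast hd
  have g2 : 0 < Real.Gamma (((d : ℝ) - 1) / 2) := Real.Gamma_pos_of_pos (by linarith)
  have hup := Gamma_add_half_sq_le (x := ((d : ℝ) - 1) / 2) (by linarith)
  have hlo := Gamma_add_half_sq_le (x := ((d : ℝ) - 2) / 2) (by linarith)
  have hrec := Real.Gamma_add_one (s := ((d : ℝ) - 2) / 2) (by linarith)
  rw [show ((d : ℝ) - 1) / 2 + 1 / 2 = (d : ℝ) / 2 by ring] at hup
  rw [show ((d : ℝ) - 2) / 2 + 1 / 2 = ((d : ℝ) - 1) / 2 by ring] at hlo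
  rw [show ((d : ℝ) - 2) / 2 + 1 = (d : ℝ) / 2 by ring] at hrec
  have hpi := Real.pi_pos
  have heq : (2 * c1 d / Real.sqrt d) ^ 2 =
      4 * Real.Gamma ((d : ℝ) / 2) ^ 2 / (Real.pi * Real.Gamma (((d : ℝ) - 1) / 2) ^ 2 * d) := by
    rw [c1, div_pow, mul_pow, div_pow, mul_pow, Real.sq_sqrt hpi.le,
      Real.sq_sqrt (by linarith : (0 : ℝ) ≤ d)]
    field_simp
    norm_num
  have hlo' : ((d : ℝ) - 2) / 2 * Real.Gamma (((d : ℝ) - 1) / 2) ^ 2 ≤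
      Real.Gamma ((d : ℝ) / 2) ^ 2 := by
    rw [hrec, mul_pow, pow_two (((d : ℝ) - 2) / 2), mul_assoc]
    exact mul_le_mul_of_nonneg_left hlo (by linarith)
  rw [heq]
  constructor
  · rw [le_div_iff₀ (by positivity)]
    calc _ = 4 * (((d : ℝ) - 2) / 2 * Real.Gamma (((d : ℝ) - 1) / 2) ^ 2) := by
          field_simp
          ring
      _ ≤ _ := by linarith
  · rw [div_le_iff₀ (by positivity)]
    calc _ ≤ 4 * (((d : ℝ) - 1) / 2 * Real.Gamma (((d : ℝ) - 1) / 2) ^ 2) := by linarith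
      _ ≤ 2 * d * Real.Gamma (((d : ℝ) - 1) / 2) ^ 2 := by
        nlinarith [sq_nonneg (Real.Gamma (((d : ℝ) - 1) / 2))]
      _ = _ := by field_simp

lemma tendsto_two_c1_div_sqrt :
    Tendsto (fun d : ℕ => 2 * c1 d / Real.sqrt d) atTop (nhds (Real.sqrt (2 / Real.pi))) := by
  have hlim : Tendsto (fun d : ℕ => 2 / Real.pi * (1 - 2 / (d : ℝ))) atTop
      (nhds (2 / Real.pi)) := by
    simpa using ((tendsto_const_div_atTop_nhds_zero_nat 2).const_sub 1).const_mul (2 / Real.pi)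
  have hsq : Tendsto (fun d : ℕ => (2 * c1 d / Real.sqrt d) ^ 2) atTop (nhds (2 / Real.pi)) :=
    tendsto_of_tendsto_of_tendsto_of_le_of_le' hlim tendsto_const_nhds
      ((eventually_ge_atTop 3).mono fun d hd => (two_c1_div_sqrt_sq_mem hd).1)
      ((eventually_ge_atTop 3).mono fun d hd => (two_c1_div_sqrt_sq_mem hd).2)
  refine hsq.sqrt.congr' ((eventually_ge_atTop 3).mono fun d hd => ?_)
  have := c1_pos (by omega : 2 ≤ d)
  exact Real.sqrt_sq (by positivity)

/-- The distribution function of the height of a spherical cap in dimension `d`. -/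
noncomputable def capCdf (d : ℕ) (h : ℝ) : ℝ :=
  c1 d * ∫ s in (-1 : ℝ)..h, (1 - s ^ 2) ^ (((d : ℝ) - 3) / 2)

lemma continuous_capCdf {d : ℕ} (hd : 3 ≤ d) : Continuous (capCdf d) := by
  have h : (3 : ℝ) ≤ d := by exact_mod_cast hd
  have hc := continuous_one_sub_sq_rpow (q := ((d : ℝ) - 3) / 2) (by linarith)
  exact continuous_const.mul
    (intervalIntegral.continuous_primitive (fun a b => hc.intervalIntegrable a b) (-1))

lemma capCdf_eq_half_add {d : ℕ} (hd : 3 ≤ d) (h : ℝ) :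
    capCdf d h = 1 / 2 + c1 d * ∫ s in (0 : ℝ)..h, (1 - s ^ 2) ^ (((d : ℝ) - 3) / 2) := by
  have h3 : (3 : ℝ) ≤ d := by exact_mod_cast hd
  have hc := continuous_one_sub_sq_rpow (q := ((d : ℝ) - 3) / 2) (by linarith)
  rw [capCdf, ← c1_mul_integral_neg_one_zero hd, ← mul_add,
    intervalIntegral.integral_add_adjacent_intervals (hc.intervalIntegrable _ _)
      (hc.intervalIntegrable _ _)]

lemma capCdf_nonneg {d : ℕ} (hd : 3 ≤ d) {h : ℝ} (h₁ : -1 ≤ h) (h₂ : h ≤ 1) :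
    0 ≤ capCdf d h :=
  mul_nonneg (c1_pos (by omega)).le <| intervalIntegral.integral_nonneg h₁ fun s hs =>
    Real.rpow_nonneg (by nlinarith [hs.1, hs.2]) _

lemma capCdf_le {d : ℕ} (hd : 3 ≤ d) {h : ℝ} (h₁ : -1 ≤ h) (h₂ : h ≤ 1) :
    capCdf d h ≤ 1 / 2 * Real.exp (2 * c1 d * max h 0) := by
  have h3 : (3 : ℝ) ≤ d := by exact_mod_cast hd
  have hp : 0 ≤ ((d : ℝ) - 3) / 2 := by linarith
  have hc := continuous_one_sub_sq_rpow hp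
  have hpos := c1_pos (by omega : 2 ≤ d)
  rw [capCdf_eq_half_add hd]
  rcases le_total h 0 with h0 | h0
  · have hI : 0 ≤ ∫ s in h..(0 : ℝ), (1 - s ^ 2) ^ (((d : ℝ) - 3) / 2) :=
      intervalIntegral.integral_nonneg h0 fun s hs =>
        Real.rpow_nonneg (by nlinarith [hs.1, hs.2]) _
    rw [intervalIntegral.integral_symm, max_eq_right h0, mul_zero, Real.exp_zero]
    nlinarith
  · have hI : ∫ s in (0 : ℝ)..h, (1 - s ^ 2) ^ (((d : ℝ) - 3) / 2) ≤ ∫ s in (0 : ℝ)..h, (1 : ℝ) :=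
      intervalIntegral.integral_mono_on h0 (hc.intervalIntegrable _ _)
        intervalIntegrable_const fun s hs =>
          Real.rpow_le_one (by nlinarith [hs.1, hs.2]) (by nlinarith [hs.1, hs.2]) hp
    rw [intervalIntegral.integral_const, smul_eq_mul, mul_one, sub_zero] at hI
    rw [max_eq_left h0]
    have := Real.add_one_le_exp (2 * c1 d * h)
    nlinarith [mul_le_mul_of_nonneg_left hI hpos.le]

lemma half_mul_one_add_le_capCdf {d : ℕ} (hd : 5 ≤ d) {h : ℝ} (h₁ : 0 ≤ h) (h₂ : h ≤ 1) :
    1 / 2 * (1 + 2 * c1 d * h * (1 - d / 2 * h ^ 2)) ≤ capCdf d h := by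
  have h5 : (5 : ℝ) ≤ d := by exact_mod_cast hd
  have hp : 1 ≤ ((d : ℝ) - 3) / 2 := by linarith
  have hc := continuous_one_sub_sq_rpow (zero_le_one.trans hp)
  have hpos := c1_pos (by omega : 2 ≤ d)
  rw [capCdf_eq_half_add (by omega)]
  have hI : ∫ s in (0 : ℝ)..h, (1 - d / 2 * h ^ 2) ≤
      ∫ s in (0 : ℝ)..h, (1 - s ^ 2) ^ (((d : ℝ) - 3) / 2) :=
    intervalIntegral.integral_mono_on h₁ intervalIntegrable_const
      (hc.intervalIntegrable _ _) fun s hs => by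
        have hs2 : s ^ 2 ≤ h ^ 2 := by gcongr; exacts [hs.1, hs.2]
        have hs1 : s ^ 2 ≤ 1 := by nlinarith
        have := one_add_mul_self_le_rpow_one_add (by linarith : -1 ≤ -s ^ 2) hp
        rw [← sub_eq_add_neg] at this
        nlinarith [sq_nonneg s]
  rw [intervalIntegral.integral_const, smul_eq_mul, sub_zero] at hI
  nlinarith [mul_le_mul_of_nonneg_left hI hpos.le]

/-- The unnormalised density of the typical facet height. -/
noncomputable def heightDensity (n d : ℕ) (h : ℝ) : ℝ :=
  (1 - h ^ 2) ^ (((d : ℝ) ^ 2 - 2 * (d : ℝ) - 1) / 2) * capCdf d h ^ (n - d)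

lemma II_eq_integral_heightDensity (n d : ℕ) (a b : ℝ) :
    II n d a b = ∫ h in a..b, heightDensity n d h := rfl

lemma continuous_heightDensity (n : ℕ) {d : ℕ} (hd : 3 ≤ d) : Continuous (heightDensity n d) := by
  have h3 : (3 : ℝ) ≤ d := by exact_mod_cast hd
  exact (continuous_one_sub_sq_rpow (by nlinarith)).mul ((continuous_capCdf hd).pow _)

lemma heightDensity_nonneg (n : ℕ) {d : ℕ} (hd : 3 ≤ d) {h : ℝ} (h₁ : -1 ≤ h) (h₂ : h ≤ 1) :
    0 ≤ heightDensity n d h :=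
  mul_nonneg (Real.rpow_nonneg (by nlinarith) _) (pow_nonneg (capCdf_nonneg hd h₁ h₂) _)

lemma heightDensity_le (n : ℕ) {d : ℕ} (hd : 3 ≤ d) {h : ℝ} (h₁ : -1 ≤ h) (h₂ : h ≤ 1) :
    heightDensity n d h ≤ (1 / 2) ^ (n - d) *
      Real.exp ((n - d : ℕ) * (2 * c1 d * max h 0) -
        ((d : ℝ) ^ 2 - 2 * d - 1) / 2 * h ^ 2) := by
  have h3 : (3 : ℝ) ≤ d := by exact_mod_cast hd
  have hA : 0 ≤ ((d : ℝ) ^ 2 - 2 * d - 1) / 2 := by nlinarith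
  have hx : 0 ≤ 1 - h ^ 2 := by nlinarith
  have e1 : (1 - h ^ 2) ^ (((d : ℝ) ^ 2 - 2 * (d : ℝ) - 1) / 2) ≤
      Real.exp (-(((d : ℝ) ^ 2 - 2 * d - 1) / 2 * h ^ 2)) := by
    calc _ ≤ Real.exp (-h ^ 2) ^ (((d : ℝ) ^ 2 - 2 * (d : ℝ) - 1) / 2) :=
          Real.rpow_le_rpow hx (by linarith [Real.add_one_le_exp (-h ^ 2)]) hA
      _ = _ := by rw [← Real.exp_mul]; ring_nf
  calc heightDensity n d h ≤ Real.exp (-(((d : ℝ) ^ 2 - 2 * d - 1) / 2 * h ^ 2)) *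
        (1 / 2 * Real.exp (2 * c1 d * max h 0)) ^ (n - d) :=
        mul_le_mul e1 (pow_le_pow_left₀ (capCdf_nonneg hd h₁ h₂) (capCdf_le hd h₁ h₂) _)
          (pow_nonneg (capCdf_nonneg hd h₁ h₂) _) (Real.exp_pos _).le
    _ = _ := by
      rw [mul_pow, ← Real.exp_nat_mul, Real.exp_sub, Real.exp_neg]
      ring

lemma le_heightDensity (n : ℕ) {d : ℕ} (hd : 5 ≤ d) {h : ℝ} (h₁ : 0 ≤ h) (h₂ : h < 1)
    (h₃ : d / 2 * h ^ 2 ≤ 1) :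
    (1 / 2) ^ (n - d) *
      Real.exp ((n - d : ℕ) * (2 * c1 d * h * (1 - d / 2 * h ^ 2) * (1 - 2 * c1 d * h)) -
        ((d : ℝ) ^ 2 - 2 * d - 1) / 2 * (h ^ 2 / (1 - h ^ 2))) ≤ heightDensity n d h := by
  have h5 : (5 : ℝ) ≤ d := by exact_mod_cast hd
  have hpos := c1_pos (by omega : 2 ≤ d)
  have hA : 0 ≤ ((d : ℝ) ^ 2 - 2 * d - 1) / 2 := by nlinarith
  have hx : 0 < 1 - h ^ 2 := by nlinarith
  have e1 : Real.exp (-(((d : ℝ) ^ 2 - 2 * d - 1) / 2 * (h ^ 2 / (1 - h ^ 2)))) ≤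
      (1 - h ^ 2) ^ (((d : ℝ) ^ 2 - 2 * (d : ℝ) - 1) / 2) := by
    rw [Real.rpow_def_of_pos hx, Real.exp_le_exp]
    have hl := Real.one_sub_inv_le_log_of_pos hx
    have : 1 - (1 - h ^ 2)⁻¹ = -(h ^ 2 / (1 - h ^ 2)) := by field_simp; ring
    rw [this] at hl
    nlinarith [mul_le_mul_of_nonneg_right hl hA]
  have e2 : 1 / 2 * Real.exp (2 * c1 d * h * (1 - d / 2 * h ^ 2) * (1 - 2 * c1 d * h)) ≤
      capCdf d h := by
    refine le_trans ?_ (half_mul_one_add_le_capCdf hd h₁ h₂.le)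
    have hY : 0 ≤ 2 * c1 d * h := by positivity
    have hq : 0 ≤ 1 - d / 2 * h ^ 2 := by linarith
    have hq' : 1 - d / 2 * h ^ 2 ≤ 1 := by
      have : 0 ≤ d / 2 * h ^ 2 := by positivity
      linarith
    generalize 2 * c1 d * h = Y at *
    generalize 1 - d / 2 * h ^ 2 = q at *
    have hy : 0 < 1 + Y * q := by positivity
    refine mul_le_mul_of_nonneg_left ?_ (by norm_num)
    rw [← Real.le_log_iff_exp_le hy]
    refine le_trans ?_ (Real.one_sub_inv_le_log_of_pos hy)
    rw [le_sub_iff_add_le, ← le_sub_iff_add_le', inv_le_iff_one_le_mul₀ hy]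
    have hYq : 0 ≤ Y * q := by positivity
    have hle : Y * q ≤ Y := by nlinarith
    have : 0 ≤ Y * q * (Y - Y * q) := mul_nonneg hYq (by linarith)
    have : 0 ≤ Y * q * (Y * (Y * q)) := by positivity
    nlinarith
  calc _ = Real.exp (-(((d : ℝ) ^ 2 - 2 * d - 1) / 2 * (h ^ 2 / (1 - h ^ 2)))) *
        (1 / 2 * Real.exp (2 * c1 d * h * (1 - d / 2 * h ^ 2) * (1 - 2 * c1 d * h))) ^ (n - d) := by
        rw [mul_pow, ← Real.exp_nat_mul, Real.exp_sub, Real.exp_neg]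
        ring
    _ ≤ _ := mul_le_mul e1 (pow_le_pow_left₀ (by positivity) e2 _) (by positivity)
        (Real.rpow_nonneg hx.le _)

/-- The length scale `(n - d) d^{-3/2}` of the typical facet height. -/
noncomputable def heightScale (n d : ℕ) : ℝ := (n - d : ℕ) / (d * Real.sqrt d)

/-- The concentration rate `(n - d)² / d` of the rescaled facet height. -/
noncomputable def heightRate (n d : ℕ) : ℝ := (n - d : ℕ) ^ 2 / d

lemma heightScale_pos {n d : ℕ} (hd : 0 < d) (hn : d < n) : 0 < heightScale n d := by
  have h1 : (0 : ℝ) < d := by exact_mod_cast hd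
  have h2 : (0 : ℝ) < (n - d : ℕ) := by exact_mod_cast Nat.sub_pos_of_lt hn
  unfold heightScale
  positivity

lemma heightScale_sq (n : ℕ) {d : ℕ} (hd : 0 < d) :
    heightScale n d ^ 2 = heightRate n d / d ^ 2 := by
  have h1 : (0 : ℝ) < d := by exact_mod_cast hd
  rw [heightScale, heightRate, div_pow, mul_pow, Real.sq_sqrt h1.le]
  field_simp

lemma heightDensity_mul_scale_le {n d : ℕ} (hd : 3 ≤ d) (hn : d < n) {x : ℝ}
    (h₁ : -1 ≤ heightScale n d * x) (h₂ : heightScale n d * x ≤ 1) :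
    heightDensity n d (heightScale n d * x) ≤ (1 / 2) ^ (n - d) *
      Real.exp (heightRate n d * (2 * c1 d / Real.sqrt d * max x 0 -
        ((d : ℝ) ^ 2 - 2 * d - 1) / d ^ 2 * x ^ 2 / 2)) := by
  have h1 : (0 : ℝ) < d := by exact_mod_cast (by omega : 0 < d)
  have ht := heightScale_pos (by omega : 0 < d) hn
  refine (heightDensity_le n hd h₁ h₂).trans_eq ?_
  have hmax : max (heightScale n d * x) 0 = heightScale n d * max x 0 := by
    rw [mul_max_of_nonneg _ _ ht.le, mul_zero]
  congr 2
  rw [hmax, mul_pow, heightScale_sq n (by omega), heightRate, heightScale, mul_sub]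
  field_simp

lemma le_heightDensity_mul_scale {n d : ℕ} (hd : 5 ≤ d) (hn : d < n)
    (hr : ((n - d : ℕ) : ℝ) / d ≤ 1 / 4) {x : ℝ} (hx₀ : 0 ≤ x) (hx₂ : x ≤ 2) :
    (1 / 2) ^ (n - d) * Real.exp (heightRate n d *
      (2 * c1 d / Real.sqrt d * (1 - 2 * (((n - d : ℕ) : ℝ) / d) ^ 2) *
          (1 - 2 * (2 * c1 d / Real.sqrt d) * (((n - d : ℕ) : ℝ) / d)) * x -
        ((d : ℝ) ^ 2 - 2 * d - 1) / d ^ 2 / (1 - 4 * (((n - d : ℕ) : ℝ) / d) ^ 2) * x ^ 2 / 2)) ≤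
      heightDensity n d (heightScale n d * x) := by
  have h5 : (5 : ℝ) ≤ d := by exact_mod_cast hd
  have h1 : (0 : ℝ) < d := by linarith
  have hpos := c1_pos (by omega : 2 ≤ d)
  have ht := heightScale_pos (by omega : 0 < d) hn
  have hs := Real.sqrt_pos.2 h1
  have hM : 2 * c1 d / Real.sqrt d ≤ 1 := by
    have := (two_c1_div_sqrt_sq_mem (by omega : 3 ≤ d)).2
    have h2 : 2 / Real.pi ≤ 1 := by
      rw [div_le_one Real.pi_pos]; linarith [Real.pi_gt_three]
    nlinarith
  have hM0 : 0 ≤ 2 * c1 d / Real.sqrt d := by positivity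
  set r : ℝ := ((n - d : ℕ) : ℝ) / d with hr_def
  have hr0 : 0 ≤ r := by positivity
  have hr2 : r ^ 2 ≤ 1 / 16 := by nlinarith
  have hx2 : x ^ 2 ≤ 4 := by nlinarith
  have hrate : heightRate n d = r ^ 2 * d := by rw [heightRate, hr_def]; field_simp
  have hq : d / 2 * (heightScale n d * x) ^ 2 = r ^ 2 * x ^ 2 / 2 := by
    rw [mul_pow, heightScale_sq n (by omega), hrate]; field_simp
  have hY : 2 * c1 d * (heightScale n d * x) = 2 * c1 d / Real.sqrt d * r * x := by
    rw [heightScale, hr_def]; field_simp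
  have hh2 : (heightScale n d * x) ^ 2 ≤ 4 * r ^ 2 := by
    have hrx : r ^ 2 * x ^ 2 ≤ r ^ 2 * 4 := by gcongr
    nlinarith [sq_nonneg (heightScale n d * x)]
  have hlt : heightScale n d * x < 1 := by
    nlinarith [mul_nonneg ht.le hx₀]
  have hrx : r ^ 2 * x ^ 2 ≤ r ^ 2 * 4 := by gcongr
  refine le_trans ?_ (le_heightDensity n hd (mul_nonneg ht.le hx₀) hlt (by rw [hq]; nlinarith))
  refine mul_le_mul_of_nonneg_left (Real.exp_le_exp.2 ?_) (by positivity)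
  rw [mul_sub]
  refine sub_le_sub ?_ ?_
  · rw [hq, hY]
    have e : ((n - d : ℕ) : ℝ) = r * d := by rw [hr_def]; field_simp
    rw [e, hrate]
    set M := 2 * c1 d / Real.sqrt d
    have hMr : M * r ≤ 1 / 4 := by nlinarith
    have hMrx : M * r * x ≤ M * r * 2 := by gcongr
    have key : (1 - 2 * r ^ 2) * (1 - 2 * M * r) ≤
        (1 - r ^ 2 * x ^ 2 / 2) * (1 - M * r * x) :=
      mul_le_mul (by linarith) (by linarith) (by linarith) (by linarith)
    have hc : 0 ≤ r ^ 2 * d * M * x := by positivity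
    nlinarith [mul_le_mul_of_nonneg_left key hc]
  · have hA : 0 ≤ ((d : ℝ) ^ 2 - 2 * d - 1) := by nlinarith
    have hden : 0 < 1 - 4 * r ^ 2 := by linarith
    calc ((d : ℝ) ^ 2 - 2 * d - 1) / 2 *
          ((heightScale n d * x) ^ 2 / (1 - (heightScale n d * x) ^ 2))
        ≤ ((d : ℝ) ^ 2 - 2 * d - 1) / 2 * ((heightScale n d * x) ^ 2 / (1 - 4 * r ^ 2)) := by
          gcongr
      _ = _ := by
          rw [mul_pow, heightScale_sq n (by omega)]
          field_simp

lemma quadratic_le_of_far {μ ε M a x : ℝ} (hμ : μ ≤ 1) (hε : 0 < ε) (hεμ : ε < μ)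
    (hM : |M - μ| ≤ ε ^ 2 / 128) (ha : |a - 1| ≤ ε ^ 2 / 128) (hx : ε ≤ |x - μ|) :
    M * max x 0 - a * x ^ 2 / 2 ≤ μ ^ 2 / 2 - ε ^ 2 / 8 - (x - μ) ^ 2 / 8 := by
  have hε1 : ε ^ 2 ≤ 1 := by nlinarith
  have hεμ2 : ε ^ 2 ≤ μ ^ 2 := by nlinarith
  have hx2 : ε ^ 2 ≤ (x - μ) ^ 2 := by rw [← sq_abs (x - μ)]; gcongr
  rw [abs_le] at hM ha
  set κ := ε ^ 2 / 128 with hκ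
  rcases le_total x 0 with h0 | h0
  · rw [max_eq_right h0]
    nlinarith [sq_nonneg (x + μ), sq_nonneg x]
  · rw [max_eq_left h0]
    have e1 : M * x ≤ (μ + κ) * x := by gcongr; linarith
    have e2 : (1 - κ) * x ^ 2 ≤ a * x ^ 2 := by gcongr; linarith
    have e3 : κ * x ≤ κ * ((1 + x ^ 2) / 2) := by
      gcongr; nlinarith [sq_nonneg (x - 1)]
    have e4 : κ * x ^ 2 ≤ κ * (2 * (x - μ) ^ 2 + 2) := by
      gcongr; nlinarith [sq_nonneg (x - 2 * μ)]
    have e5 : κ * (x - μ) ^ 2 ≤ 1 / 128 * (x - μ) ^ 2 := by gcongr; linarith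
    nlinarith

lemma le_quadratic_of_near {μ ε l u x : ℝ} (hμ0 : 0 ≤ μ) (hμ : μ ≤ 1) (hε : 0 < ε) (hε1 : ε ≤ 1)
    (hl : |l - μ| ≤ ε ^ 2 / 128) (hu : |u - 1| ≤ ε ^ 2 / 128) (hx : μ ≤ x)
    (hx' : x ≤ μ + ε / 4) :
    μ ^ 2 / 2 - ε ^ 2 / 16 ≤ l * x - u * x ^ 2 / 2 := by
  rw [abs_le] at hl hu
  set κ := ε ^ 2 / 128 with hκ
  have hx0 : 0 ≤ x := hμ0.trans hx
  have hκ0 : 0 ≤ κ := by positivity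
  have hx2 : x ≤ 5 / 4 := by linarith
  have e1 : (μ - κ) * x ≤ l * x := by gcongr; linarith
  have e2 : u * x ^ 2 ≤ (1 + κ) * x ^ 2 := by gcongr; linarith
  have e3 : κ * x ≤ κ * 2 := by gcongr; linarith
  have e4 : κ * x ^ 2 ≤ κ * 4 := by gcongr; nlinarith
  have e5 : (x - μ) ^ 2 ≤ (ε / 4) ^ 2 := by gcongr; linarith
  nlinarith

lemma intervalIntegral_exp_neg_sq_le {c t μ a b : ℝ} (hc : 0 < c) (ht : 0 < t) (hab : a ≤ b) :
    ∫ h in a..b, Real.exp (-(c * (h / t - μ) ^ 2)) ≤ t * Real.sqrt (Real.pi / c) := by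
  have e : (fun h : ℝ => Real.exp (-(c * (h / t - μ) ^ 2))) =
      fun h : ℝ => Real.exp (-(c / t ^ 2) * (h - μ * t) ^ 2) := by
    funext h
    congr 1
    field_simp
  have hi : MeasureTheory.Integrable fun h : ℝ => Real.exp (-(c / t ^ 2) * (h - μ * t) ^ 2) :=
    (integrable_exp_neg_mul_sq (by positivity)).comp_sub_right (μ * t)
  rw [e, intervalIntegral.integral_of_le hab]
  refine (MeasureTheory.setIntegral_le_integral hi
    (Eventually.of_forall fun h => (Real.exp_pos _).le)).trans_eq ?_
  rw [MeasureTheory.integral_sub_right_eq_self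
    (fun h : ℝ => Real.exp (-(c / t ^ 2) * h ^ 2)) (μ * t), integral_gaussian,
    show Real.pi / (c / t ^ 2) = t ^ 2 * (Real.pi / c) by field_simp,
    Real.sqrt_mul (by positivity), Real.sqrt_sq ht.le]

lemma II_le_of_far {n d : ℕ} {μ ε a b : ℝ} (hd : 3 ≤ d) (hn : d < n) (hμ : μ ≤ 1) (hε : 0 < ε)
    (hεμ : ε < μ) (hM : |2 * c1 d / Real.sqrt d - μ| ≤ ε ^ 2 / 128)
    (hA : |((d : ℝ) ^ 2 - 2 * d - 1) / d ^ 2 - 1| ≤ ε ^ 2 / 128)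
    (hrate : 1 ≤ heightRate n d) (ha : -1 ≤ a) (hab : a ≤ b) (hb : b ≤ 1)
    (hfar : ∀ h ∈ Set.Icc a b, ε ≤ |h / heightScale n d - μ|) :
    II n d a b ≤ (1 / 2) ^ (n - d) *
      Real.exp (heightRate n d * (μ ^ 2 / 2 - ε ^ 2 / 8)) *
        (heightScale n d * Real.sqrt (8 * Real.pi)) := by
  have ht := heightScale_pos (by omega : 0 < d) hn
  set t := heightScale n d with ht_def
  set R := heightRate n d with hR_def
  have hpt : ∀ h ∈ Set.Icc a b, heightDensity n d h ≤
      (1 / 2) ^ (n - d) * Real.exp (R * (μ ^ 2 / 2 - ε ^ 2 / 8)) *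
        Real.exp (-(R / 8 * (h / t - μ) ^ 2)) := by
    intro h hh
    have hth : t * (h / t) = h := by field_simp
    have hle := heightDensity_mul_scale_le hd hn (x := h / t)
      (by rw [← ht_def, hth]; linarith [hh.1]) (by rw [← ht_def, hth]; linarith [hh.2])
    rw [← ht_def, hth] at hle
    refine hle.trans ?_
    rw [mul_assoc, ← Real.exp_add]
    refine mul_le_mul_of_nonneg_left (Real.exp_le_exp.2 ?_) (by positivity)
    have := mul_le_mul_of_nonneg_left (quadratic_le_of_far hμ hε hεμ hM hA (hfar h hh))
      (zero_le_one.trans hrate)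
    linarith
  have hcont : Continuous fun h : ℝ => (1 / 2) ^ (n - d) * Real.exp (R * (μ ^ 2 / 2 - ε ^ 2 / 8)) *
      Real.exp (-(R / 8 * (h / t - μ) ^ 2)) := by fun_prop
  rw [II_eq_integral_heightDensity]
  calc ∫ h in a..b, heightDensity n d h
      ≤ ∫ h in a..b, (1 / 2) ^ (n - d) * Real.exp (R * (μ ^ 2 / 2 - ε ^ 2 / 8)) *
        Real.exp (-(R / 8 * (h / t - μ) ^ 2)) :=
        intervalIntegral.integral_mono_on hab
          ((continuous_heightDensity n hd).intervalIntegrable _ _)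
          (hcont.intervalIntegrable _ _) hpt
    _ ≤ (1 / 2) ^ (n - d) * Real.exp (R * (μ ^ 2 / 2 - ε ^ 2 / 8)) *
        (t * Real.sqrt (Real.pi / (R / 8))) := by
        rw [intervalIntegral.integral_const_mul]
        exact mul_le_mul_of_nonneg_left
          (intervalIntegral_exp_neg_sq_le (by linarith) ht hab) (by positivity)
    _ ≤ _ := by
        refine mul_le_mul_of_nonneg_left (mul_le_mul_of_nonneg_left (Real.sqrt_le_sqrt ?_) ht.le)
          (by positivity)
        rw [div_le_iff₀ (by linarith)]
        nlinarith [Real.pi_pos]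

lemma le_II_neg_one_one {n d : ℕ} {μ ε : ℝ} (hd : 5 ≤ d) (hn : d < n)
    (hr : ((n - d : ℕ) : ℝ) / d ≤ 1 / 4) (hμ0 : 0 ≤ μ) (hμ : μ ≤ 1) (hε : 0 < ε) (hε1 : ε ≤ 1)
    (hl : |2 * c1 d / Real.sqrt d * (1 - 2 * (((n - d : ℕ) : ℝ) / d) ^ 2) *
      (1 - 2 * (2 * c1 d / Real.sqrt d) * (((n - d : ℕ) : ℝ) / d)) - μ| ≤ ε ^ 2 / 128)
    (hu : |((d : ℝ) ^ 2 - 2 * d - 1) / d ^ 2 / (1 - 4 * (((n - d : ℕ) : ℝ) / d) ^ 2) - 1| ≤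
      ε ^ 2 / 128) (hscale : heightScale n d ≤ 1 / 4) :
    (1 / 2) ^ (n - d) * Real.exp (heightRate n d * (μ ^ 2 / 2 - ε ^ 2 / 16)) *
      (heightScale n d * (ε / 4)) ≤ II n d (-1) 1 := by
  have ht := heightScale_pos (by omega : 0 < d) hn
  have hR : 0 ≤ heightRate n d := by unfold heightRate; positivity
  set t := heightScale n d with ht_def
  have hlen : t * μ ≤ t * (μ + ε / 4) := by gcongr; linarith
  have htop : t * (μ + ε / 4) ≤ 1 := by nlinarith
  have hbot : 0 ≤ t * μ := by positivity
  have hpt : ∀ h ∈ Set.Icc (t * μ) (t * (μ + ε / 4)),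
      (1 / 2) ^ (n - d) * Real.exp (heightRate n d * (μ ^ 2 / 2 - ε ^ 2 / 16)) ≤
        heightDensity n d h := by
    intro h hh
    have hth : t * (h / t) = h := by field_simp
    have hx1 : μ ≤ h / t := by rw [le_div_iff₀ ht, mul_comm]; exact hh.1
    have hx2 : h / t ≤ μ + ε / 4 := by rw [div_le_iff₀ ht, mul_comm]; exact hh.2
    have hle := le_heightDensity_mul_scale hd hn hr (x := h / t) (hμ0.trans hx1) (by linarith)
    rw [← ht_def, hth] at hle
    refine le_trans ?_ hle
    refine mul_le_mul_of_nonneg_left (Real.exp_le_exp.2 ?_) (by positivity)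
    exact mul_le_mul_of_nonneg_left (le_quadratic_of_near hμ0 hμ hε hε1 hl hu hx1 hx2) hR
  have hc := continuous_heightDensity n (by omega : 3 ≤ d)
  rw [II_eq_integral_heightDensity]
  calc _ = ∫ _ in (t * μ)..(t * (μ + ε / 4)),
        (1 / 2) ^ (n - d) * Real.exp (heightRate n d * (μ ^ 2 / 2 - ε ^ 2 / 16)) := by
        rw [intervalIntegral.integral_const, smul_eq_mul]; ring
    _ ≤ ∫ h in (t * μ)..(t * (μ + ε / 4)), heightDensity n d h :=
        intervalIntegral.integral_mono_on hlen intervalIntegrable_const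
          (hc.intervalIntegrable _ _) hpt
    _ ≤ _ := by
        refine intervalIntegral.integral_mono_interval (by linarith) hlen htop ?_
          (hc.intervalIntegrable _ _)
        refine (MeasureTheory.ae_restrict_iff' measurableSet_Ioc).2
          (Eventually.of_forall fun h hh => ?_)
        exact heightDensity_nonneg n (by omega) hh.1.le hh.2

lemma II_nonneg (n : ℕ) {d : ℕ} (hd : 3 ≤ d) {a b : ℝ} (ha : -1 ≤ a) (hab : a ≤ b) (hb : b ≤ 1) :
    0 ≤ II n d a b :=
  intervalIntegral.integral_nonneg hab fun _ hh =>
    heightDensity_nonneg n hd (ha.trans hh.1) (hh.2.trans hb)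

lemma II_add_adjacent (n : ℕ) {d : ℕ} (hd : 3 ≤ d) (a b c : ℝ) :
    II n d a b + II n d b c = II n d a c :=
  intervalIntegral.integral_add_adjacent_intervals
    ((continuous_heightDensity n hd).intervalIntegrable _ _)
    ((continuous_heightDensity n hd).intervalIntegrable _ _)

lemma div_le_of_exp_bounds {L R μ ε t S I J : ℝ} (hL : 0 < L) (ht : 0 < t) (hS : 0 ≤ S) (hε : 0 < ε)
    (hI : I ≤ L * Real.exp (R * (μ ^ 2 / 2 - ε ^ 2 / 8)) * (t * S))
    (hJ : L * Real.exp (R * (μ ^ 2 / 2 - ε ^ 2 / 16)) * (t * (ε / 4)) ≤ J) :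
    I / J ≤ S / (ε / 4) * Real.exp (-(R * (ε ^ 2 / 16))) := by
  have hJ0 : 0 < L * Real.exp (R * (μ ^ 2 / 2 - ε ^ 2 / 16)) * (t * (ε / 4)) := by positivity
  rw [div_le_iff₀ (hJ0.trans_le hJ)]
  refine hI.trans (le_trans (le_of_eq ?_) (mul_le_mul_of_nonneg_left hJ (by positivity)))
  rw [show R * (μ ^ 2 / 2 - ε ^ 2 / 8) =
    -(R * (ε ^ 2 / 16)) + R * (μ ^ 2 / 2 - ε ^ 2 / 16) by ring, Real.exp_add]
  field_simp

/-- if `d → ∞`, `(n-d)/√d → ∞` and `(n-d)/d → 0`, then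
`(d^{3/2}/(n-d))·H_typ → √(2/π)` in probability. -/
theorem typical_height_sublinear2 (d : ℕ → ℕ)
    (hd : ∀ᶠ n in atTop, 2 ≤ d n ∧ d n < n)
    (hdi : Tendsto (fun n : ℕ => (d n : ℝ)) atTop atTop)
    (hfast : Tendsto (fun n : ℕ => ((n : ℝ) - (d n : ℝ)) / Real.sqrt (d n)) atTop atTop)
    (hslow : Tendsto (fun n : ℕ => ((n : ℝ) - (d n : ℝ)) / (d n : ℝ)) atTop (nhds 0)) :
    ∀ ε : ℝ, 0 < ε → ε < Real.sqrt (2 / Real.pi) →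
      Tendsto (fun n : ℕ =>
          II n (d n) (-1)
            ((Real.sqrt (2 / Real.pi) - ε) * ((n : ℝ) - (d n : ℝ)) * (d n : ℝ) ^ (-(3 : ℝ) / 2)) /
          II n (d n) (-1) 1) atTop (nhds 0) ∧
      Tendsto (fun n : ℕ =>
          II n (d n) (-1)
            ((Real.sqrt (2 / Real.pi) + ε) * ((n : ℝ) - (d n : ℝ)) * (d n : ℝ) ^ (-(3 : ℝ) / 2)) /
          II n (d n) (-1) 1) atTop (nhds 1) := by
  intro ε hε hεμ
  set μ := Real.sqrt (2 / Real.pi) with hμ_def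
  have hμ0 : 0 ≤ μ := Real.sqrt_nonneg _
  have hμ1 : μ ≤ 1 := by
    rw [hμ_def, Real.sqrt_le_one, div_le_one Real.pi_pos]
    linarith [Real.pi_gt_three]
  have hκ : 0 < ε ^ 2 / 128 := by positivity
  have hdn : Tendsto d atTop atTop := tendsto_natCast_atTop_iff.1 hdi
  have hcast : ∀ᶠ n : ℕ in atTop, (n : ℝ) - (d n : ℝ) = ((n - d n : ℕ) : ℝ) :=
    hd.mono fun n hn => (Nat.cast_sub hn.2.le).symm
  have hr : Tendsto (fun n : ℕ => ((n - d n : ℕ) : ℝ) / (d n : ℝ)) atTop (nhds 0) :=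
    hslow.congr' (hcast.mono fun n hn => by simp only [hn])
  have hM : Tendsto (fun n => 2 * c1 (d n) / Real.sqrt (d n)) atTop (nhds μ) :=
    tendsto_two_c1_div_sqrt.comp hdn
  have hinv : Tendsto (fun n => ((d n : ℝ))⁻¹) atTop (nhds 0) := tendsto_inv_atTop_zero.comp hdi
  have hA : Tendsto (fun n => ((d n : ℝ) ^ 2 - 2 * d n - 1) / (d n : ℝ) ^ 2) atTop (nhds 1) := by
    have : Tendsto (fun n => 1 - 2 * ((d n : ℝ))⁻¹ - ((d n : ℝ))⁻¹ ^ 2) atTop (nhds 1) := by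
      simpa using ((hinv.const_mul 2).const_sub 1).sub (hinv.pow 2)
    refine this.congr' (hd.mono fun n hn => ?_)
    have : (d n : ℝ) ≠ 0 := by have := hn.1; positivity
    field_simp
  have hl : Tendsto (fun n => 2 * c1 (d n) / Real.sqrt (d n) *
      (1 - 2 * (((n - d n : ℕ) : ℝ) / (d n : ℝ)) ^ 2) *
      (1 - 2 * (2 * c1 (d n) / Real.sqrt (d n)) * (((n - d n : ℕ) : ℝ) / (d n : ℝ))))
      atTop (nhds μ) := by
    simpa using (hM.mul (((hr.pow 2).const_mul 2).const_sub 1)).mul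
      (((hM.const_mul 2).mul hr).const_sub 1)
  have hu : Tendsto (fun n => ((d n : ℝ) ^ 2 - 2 * d n - 1) / (d n : ℝ) ^ 2 /
      (1 - 4 * (((n - d n : ℕ) : ℝ) / (d n : ℝ)) ^ 2)) atTop (nhds 1) := by
    simpa [Pi.div_def] using hA.div (((hr.pow 2).const_mul 4).const_sub 1) (by norm_num)
  have hrate : Tendsto (fun n => heightRate n (d n)) atTop atTop := by
    refine ((tendsto_pow_atTop two_ne_zero).comp hfast).congr' (hcast.mono fun n hn => ?_)
    simp only [Function.comp, hn]
    rw [div_pow, Real.sq_sqrt (Nat.cast_nonneg _), heightRate]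
  have hbound : Tendsto (fun n => Real.sqrt (8 * Real.pi) / (ε / 4) *
      Real.exp (-(heightRate n (d n) * (ε ^ 2 / 16)))) atTop (nhds 0) := by
    simpa using (Real.tendsto_exp_neg_atTop_nhds_zero.comp
      (hrate.atTop_mul_const (by positivity : 0 < ε ^ 2 / 16))).const_mul
        (Real.sqrt (8 * Real.pi) / (ε / 4))
  have hev : ∀ {f : ℕ → ℝ} {c : ℝ}, Tendsto f atTop (nhds c) →
      ∀ᶠ n in atTop, |f n - c| ≤ ε ^ 2 / 128 := fun hf =>
    (hf.eventually (Metric.closedBall_mem_nhds _ hκ)).mono fun n hn => hn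
  have hall : ∀ᶠ n in atTop, 0 < II n (d n) (-1) 1 ∧
      (∀ x : ℝ, x * ((n : ℝ) - (d n : ℝ)) * (d n : ℝ) ^ (-(3 : ℝ) / 2) =
        x * heightScale n (d n)) ∧
      0 ≤ II n (d n) (-1) ((μ - ε) * heightScale n (d n)) / II n (d n) (-1) 1 ∧
      II n (d n) (-1) ((μ - ε) * heightScale n (d n)) / II n (d n) (-1) 1 ≤
        Real.sqrt (8 * Real.pi) / (ε / 4) * Real.exp (-(heightRate n (d n) * (ε ^ 2 / 16))) ∧
      0 ≤ II n (d n) ((μ + ε) * heightScale n (d n)) 1 / II n (d n) (-1) 1 ∧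
      II n (d n) ((μ + ε) * heightScale n (d n)) 1 / II n (d n) (-1) 1 ≤
        Real.sqrt (8 * Real.pi) / (ε / 4) *
          Real.exp (-(heightRate n (d n) * (ε ^ 2 / 16))) := by
    filter_upwards [hd, hcast, hdn.eventually_ge_atTop 5, hev hM, hev hA, hev hl, hev hu,
      hrate.eventually_ge_atTop 1, hr.eventually_le_const (by norm_num : (0 : ℝ) < 1 / 4)]
      with n hn hc h5 hM hA hl hu hR hr
    have hD : (5 : ℝ) ≤ d n := by exact_mod_cast h5
    have ht := heightScale_pos (by omega : 0 < d n) hn.2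
    have hts : heightScale n (d n) ≤ 1 / 4 := by
      refine le_trans ?_ hr
      rw [heightScale, ← div_div]
      exact div_le_self (by positivity) (Real.one_le_sqrt.2 (by linarith))
    have hJ := le_II_neg_one_one h5 hn.2 hr hμ0 hμ1 hε (by linarith) hl hu hts
    have hJ0 : 0 < II n (d n) (-1) 1 := lt_of_lt_of_le (by positivity) hJ
    have hlo : -1 ≤ (μ - ε) * heightScale n (d n) := by
      have : 0 ≤ (μ - ε) * heightScale n (d n) := mul_nonneg (by linarith) ht.le
      linarith
    have hlo' : (μ - ε) * heightScale n (d n) ≤ 1 := by nlinarith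
    have hhi : (μ + ε) * heightScale n (d n) ≤ 1 := by nlinarith
    have hhi' : -1 ≤ (μ + ε) * heightScale n (d n) := by
      have : 0 ≤ (μ + ε) * heightScale n (d n) := by positivity
      linarith
    refine ⟨hJ0, fun x => ?_,
      div_nonneg (II_nonneg n (by omega) le_rfl hlo hlo') hJ0.le,
      div_le_of_exp_bounds (by positivity) ht (Real.sqrt_nonneg _) hε
        (II_le_of_far (by omega) hn.2 hμ1 hε hεμ hM hA hR le_rfl hlo hlo' fun h hh => ?_) hJ,
      div_nonneg (II_nonneg n (by omega) hhi' hhi le_rfl) hJ0.le,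
      div_le_of_exp_bounds (by positivity) ht (Real.sqrt_nonneg _) hε
        (II_le_of_far (by omega) hn.2 hμ1 hε hεμ hM hA hR hhi' hhi le_rfl fun h hh => ?_) hJ⟩
    · have hD0 : (0 : ℝ) < d n := by linarith
      rw [hc, heightScale, show (-(3 : ℝ) / 2) = -(1 + 1 / 2) by norm_num,
        Real.rpow_neg hD0.le, Real.rpow_add hD0, Real.rpow_one, ← Real.sqrt_eq_rpow]
      field_simp
    · have : h / heightScale n (d n) ≤ μ - ε := (div_le_iff₀ ht).2 hh.2
      rw [abs_sub_comm]
      exact le_trans (by linarith) (le_abs_self _)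
    · have : μ + ε ≤ h / heightScale n (d n) := (le_div_iff₀ ht).2 hh.1
      exact le_trans (by linarith) (le_abs_self _)
  constructor
  · refine tendsto_of_tendsto_of_tendsto_of_le_of_le' tendsto_const_nhds hbound ?_ ?_
    · filter_upwards [hall] with n hn
      rw [hn.2.1]
      exact hn.2.2.1
    · filter_upwards [hall] with n hn
      rw [hn.2.1]
      exact hn.2.2.2.1
  · have hup : Tendsto (fun n => II n (d n) ((μ + ε) * heightScale n (d n)) 1 /
        II n (d n) (-1) 1) atTop (nhds 0) :=
      tendsto_of_tendsto_of_tendsto_of_le_of_le' tendsto_const_nhds hbound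
        (hall.mono fun n hn => hn.2.2.2.2.1) (hall.mono fun n hn => hn.2.2.2.2.2)
    have hsub := hup.const_sub 1
    rw [sub_zero] at hsub
    refine hsub.congr' ?_
    filter_upwards [hall, hdn.eventually_ge_atTop 5] with n hn h5
    rw [hn.2.1, ← II_add_adjacent n (by omega : 3 ≤ d n) (-1)
      ((μ + ε) * heightScale n (d n)) 1]
    have := hn.1
    rw [← II_add_adjacent n (by omega : 3 ≤ d n) (-1) ((μ + ε) * heightScale n (d n)) 1] at this
    field_simp
    ring
end
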